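/- arXiv:2304.04402 — 3 statements merged into one kernel-verified Lean document; each statement's English description precedes it below -/
import Mathlib

section
/- Let λ ∈ [0,1), B ≥ 0, and let g^{(0)}, g^{(1)}, … be vectors in ℂ^n with ‖g^{(τ)}‖₂² ≤ B for all τ. Define Δ^{(0)} = 0 and, for each t ≥ 0, Δ^{(t+1)} = a^{(t)} − s^{(t)}, where a^{(t)} = g^{(t)} + Δ^{(t)} and s^{(t)} is any vector satisfying ‖a^{(t)} − s^{(t)}‖₂ ≤ λ‖a^{(t)}‖₂. Then for every t ≥ 1, ‖Δ^{(t)}‖₂² ≤ B · λ²(1 − λ^t)²/(1 − λ)² ≤ B · λ²/(1 − λ)². -/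
/-- If `u` starts at `0` and contracts as `u (t + 1) ≤ l * (b + u t)`, then `u` is bounded by the
geometric sum `b * (l + l ^ 2 + ⋯ + l ^ t)`, written in closed form. -/
theorem le_geom_of_le_mul_add {l b : ℝ} (hl0 : 0 ≤ l) (hl1 : l < 1) {u : ℕ → ℝ} (h0 : u 0 = 0)
    (hu : ∀ t, u (t + 1) ≤ l * (b + u t)) (t : ℕ) :
    u t ≤ b * l * (1 - l ^ t) / (1 - l) := by
  have hne : 1 - l ≠ 0 := (sub_pos.2 hl1).ne'
  induction t with
  | zero => simp [h0]
  | succ t ih =>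
    calc u (t + 1) ≤ l * (b + u t) := hu t
      _ ≤ l * (b + b * l * (1 - l ^ t) / (1 - l)) := by gcongr
      _ = b * l * (1 - l ^ (t + 1)) / (1 - l) := by
        field_simp
        ring

/-- Uniformly bounded gradients give a uniformly bounded accumulated compression error:
`‖Δ t‖² ≤ B·l²(1-l^t)²/(1-l)² ≤ B·l²/(1-l)²`. -/
theorem stmt_4 (n : ℕ) (l : ℝ) (hl : l ∈ Set.Ico (0 : ℝ) 1) (B : ℝ) (hB : 0 ≤ B)
    (g s Δ : ℕ → EuclideanSpace ℂ (Fin n))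
    (hg : ∀ τ, ‖g τ‖ ^ 2 ≤ B)
    (h0 : Δ 0 = 0)
    (hrec : ∀ t, Δ (t + 1) = (g t + Δ t) - s t)
    (hcontr : ∀ t, ‖(g t + Δ t) - s t‖ ≤ l * ‖g t + Δ t‖) :
    ∀ t, 1 ≤ t →
      ‖Δ t‖ ^ 2 ≤ B * l ^ 2 * (1 - l ^ t) ^ 2 / (1 - l) ^ 2 ∧
      B * l ^ 2 * (1 - l ^ t) ^ 2 / (1 - l) ^ 2 ≤ B * l ^ 2 / (1 - l) ^ 2 := by
  obtain ⟨hl0, hl1⟩ := hl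
  have hstep : ∀ t, ‖Δ (t + 1)‖ ≤ l * (√B + ‖Δ t‖) := fun t => by
    rw [hrec]
    refine (hcontr t).trans (mul_le_mul_of_nonneg_left ?_ hl0)
    exact (norm_add_le _ _).trans (add_le_add_left (Real.le_sqrt_of_sq_le (hg t)) _)
  intro t _
  constructor
  · calc ‖Δ t‖ ^ 2 ≤ (√B * l * (1 - l ^ t) / (1 - l)) ^ 2 := by
          gcongr
          exact le_geom_of_le_mul_add (u := fun t => ‖Δ t‖) hl0 hl1 (by simp [h0]) hstep t
      _ = B * l ^ 2 * (1 - l ^ t) ^ 2 / (1 - l) ^ 2 := by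
          rw [div_pow, mul_pow, mul_pow, Real.sq_sqrt hB]
  · have hpow : (1 - l ^ t) ^ 2 ≤ 1 :=
      pow_le_one₀ (sub_nonneg.2 (pow_le_one₀ hl0 hl1.le)) (sub_le_self _ (pow_nonneg hl0 t))
    exact div_le_div_of_nonneg_right (mul_le_of_le_one_right (by positivity) hpow)
      (by positivity)
end

section
/- Let λ ∈ [0,1), M ≥ 1, χ₁, χ₂, G ≥ 0, and let q₁, …, q_M ∈ [0,1] with Σ_{m=1}^M q_m = 1. For each m ∈ {1,…,M}, let g_m^{(0)}, g_m^{(1)}, … be vectors in ℂ^n with ‖g_m^{(τ)}‖₂² ≤ χ₁ + χ₂·G for all τ, and define Δ_m^{(0)} = 0 and Δ_m^{(τ+1)} = a_m^{(τ)} − s_m^{(τ)}, where a_m^{(τ)} = g_m^{(τ)} + Δ_m^{(τ)} and ‖a_m^{(τ)} − s_m^{(τ)}‖₂ ≤ λ‖a_m^{(τ)}‖₂. Then for every t ≥ 0, ‖Σ_{m=1}^M q_m (Δ_m^{(t)} + Δ_m^{(t+1)})‖₂² ≤ 4M·(λ²/(1−λ)²)·(χ₁ + χ₂·G). -/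
/-- Under error feedback with an `l`-contractive compressor and inputs bounded by `B`, the
accumulated error never exceeds `l / (1 - l) * B`. -/
theorem norm_errorFeedback_le {E : Type*} [SeminormedAddCommGroup E] {l B : ℝ}
    (hl₀ : 0 ≤ l) (hl₁ : l < 1) (hB : 0 ≤ B) {g e : ℕ → E} (hg : ∀ τ, ‖g τ‖ ≤ B)
    (h0 : e 0 = 0) (hstep : ∀ τ, ‖e (τ + 1)‖ ≤ l * ‖g τ + e τ‖) (t : ℕ) :
    ‖e t‖ ≤ l / (1 - l) * B := by
  have hpos : 0 < 1 - l := sub_pos.2 hl₁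
  induction t with
  | zero => simpa [h0] using by positivity
  | succ t ih =>
    calc ‖e (t + 1)‖ ≤ l * ‖g t + e t‖ := hstep t
      _ ≤ l * (B + l / (1 - l) * B) := by
        gcongr
        exact (norm_add_le _ _).trans (add_le_add (hg t) ih)
      _ = l / (1 - l) * B := by
        field_simp
        ring

/-- A convex combination of vectors of norm at most `C` has norm at most `C`. -/
theorem norm_sum_smul_le_of_sum_eq_one {ι E : Type*} [Fintype ι] [SeminormedAddCommGroup E]
    [NormedSpace ℝ E] {q : ι → ℝ} (hq : ∀ i, 0 ≤ q i) (hsum : ∑ i, q i = 1) {v : ι → E} {C : ℝ}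
    (hv : ∀ i, ‖v i‖ ≤ C) : ‖∑ i, q i • v i‖ ≤ C :=
  calc ‖∑ i, q i • v i‖ ≤ ∑ i, q i * C := norm_sum_le_of_le _ fun i _ => by
        rw [norm_smul, Real.norm_of_nonneg (hq i)]
        exact mul_le_mul_of_nonneg_left (hv i) (hq i)
    _ = C := by rw [← Finset.sum_mul, hsum, one_mul]

/-- Deterministic core of the sparsification-error bound (Lemma 2). -/
theorem stmt_5 (n M : ℕ) (hM : 1 ≤ M) (l : ℝ) (hl : l ∈ Set.Ico (0 : ℝ) 1)
    (χ₁ χ₂ G : ℝ) (hχ₁ : 0 ≤ χ₁) (hχ₂ : 0 ≤ χ₂) (hG : 0 ≤ G)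
    (q : Fin M → ℝ) (hq : ∀ m, q m ∈ Set.Icc (0 : ℝ) 1) (hqsum : ∑ m, q m = 1)
    (g s Δ : Fin M → ℕ → EuclideanSpace ℂ (Fin n))
    (hg : ∀ m τ, ‖g m τ‖ ^ 2 ≤ χ₁ + χ₂ * G)
    (h0 : ∀ m, Δ m 0 = 0)
    (hrec : ∀ m τ, Δ m (τ + 1) = (g m τ + Δ m τ) - s m τ)
    (hcontr : ∀ m τ, ‖(g m τ + Δ m τ) - s m τ‖ ≤ l * ‖g m τ + Δ m τ‖) :
    ∀ t, ‖∑ m, q m • (Δ m t + Δ m (t + 1))‖ ^ 2 ≤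
      4 * (M : ℝ) * (l ^ 2 / (1 - l) ^ 2) * (χ₁ + χ₂ * G) := by
  intro t
  have hK : 0 ≤ χ₁ + χ₂ * G := by positivity
  have hM' : (1 : ℝ) ≤ M := by exact_mod_cast hM
  have hΔ (m : Fin M) (τ : ℕ) : ‖Δ m τ‖ ≤ l / (1 - l) * √(χ₁ + χ₂ * G) :=
    norm_errorFeedback_le hl.1 hl.2 (Real.sqrt_nonneg _) (fun τ => Real.le_sqrt_of_sq_le (hg m τ))
      (h0 m) (fun τ => hrec m τ ▸ hcontr m τ) τ
  have hsum : ‖∑ m, q m • (Δ m t + Δ m (t + 1))‖ ≤ 2 * (l / (1 - l) * √(χ₁ + χ₂ * G)) :=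
    norm_sum_smul_le_of_sum_eq_one (fun m => (hq m).1) hqsum fun m =>
      (norm_add_le _ _).trans (by linarith [hΔ m t, hΔ m (t + 1)])
  calc ‖∑ m, q m • (Δ m t + Δ m (t + 1))‖ ^ 2
      ≤ (2 * (l / (1 - l) * √(χ₁ + χ₂ * G))) ^ 2 := by gcongr
    _ = 4 * 1 * (l ^ 2 / (1 - l) ^ 2) * (χ₁ + χ₂ * G) := by
      rw [mul_pow, mul_pow, Real.sq_sqrt hK, div_pow]
      ring
    _ ≤ 4 * (M : ℝ) * (l ^ 2 / (1 - l) ^ 2) * (χ₁ + χ₂ * G) := by gcongr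
end

section
/- Let F : ℝ^D → ℝ be differentiable with ω-Lipschitz continuous gradient (ω > 0) and strongly μ-convex (μ > 0) with global minimizer θ⋆. Let M ≥ 1, χ₁, χ₂ ≥ 0, λ ∈ [0,1), and suppose 4χ₂Mλ²/(1−λ)² ≤ 1/2. Let θ ∈ ℝ^D and ĝ ∈ ℝ^D satisfy ‖∇F(θ) − ĝ‖₂² ≤ 2(E_sp + E_com), where E_com ≥ 0 and 0 ≤ E_sp ≤ (4Mλ²/(1−λ)²)·(χ₁ + χ₂‖∇F(θ)‖₂²). Set θ' = θ − (1/ω)·ĝ. Then F(θ') − F(θ⋆) ≤ Ψ·(F(θ) − F(θ⋆)) + (1/ω)·(4χ₁Mλ²/(1−λ)² + E_com), where Ψ = 1 − μ/ω + 8μχ₂Mλ²/(ω(1−λ)²). -/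
open scoped RealInnerProductSpace

section DescentLemma

variable {E : Type*} [NormedAddCommGroup E] [InnerProductSpace ℝ E] [CompleteSpace E]
  {F : E → ℝ}

/-- The descent lemma: a function with `ω`-Lipschitz gradient lies below its quadratic
upper model. -/
theorem le_quadratic_of_lipschitz_gradient {ω : ℝ} (hdiff : Differentiable ℝ F)
    (hlip : ∀ x y : E, ‖gradient F x - gradient F y‖ ≤ ω * ‖x - y‖) (x v : E) :
    F (x + v) ≤ F x + ⟪gradient F x, v⟫ + ω / 2 * ‖v‖ ^ 2 := by
  let φ : ℝ → ℝ := fun t => F (x + t • v) - t * ⟪gradient F x, v⟫ - ω / 2 * ‖v‖ ^ 2 * t ^ 2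
  have hφ (t : ℝ) : HasDerivAt φ
      (⟪gradient F (x + t • v), v⟫ - ⟪gradient F x, v⟫ - ω * ‖v‖ ^ 2 * t) t := by
    have hline : HasDerivAt (fun t : ℝ => x + t • v) v t := by
      simpa using ((hasDerivAt_id t).smul_const v).const_add x
    have hF := (hdiff (x + t • v)).hasGradientAt.hasFDerivAt.comp_hasDerivAt t hline
    rw [InnerProductSpace.toDual_apply_apply] at hF
    refine ((hF.sub ((hasDerivAt_id t).mul_const ⟪gradient F x, v⟫)).sub
      ((hasDerivAt_pow 2 t).const_mul (ω / 2 * ‖v‖ ^ 2))).congr_deriv ?_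
    push_cast
    ring
  have hanti : AntitoneOn φ (Set.Icc 0 1) := by
    refine antitoneOn_of_deriv_nonpos (convex_Icc 0 1)
      (fun t _ => (hφ t).continuousAt.continuousWithinAt)
      (fun t _ => (hφ t).differentiableAt.differentiableWithinAt) fun t ht => ?_
    have ht0 : 0 ≤ t := (interior_subset ht).1
    have hgrad : ‖gradient F (x + t • v) - gradient F x‖ ≤ ω * (t * ‖v‖) := by
      simpa [norm_smul, abs_of_nonneg ht0] using hlip (x + t • v) x
    have hinner := (real_inner_le_norm (gradient F (x + t • v) - gradient F x) v).trans
      (mul_le_mul_of_nonneg_right hgrad (norm_nonneg v))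
    rw [inner_sub_left] at hinner
    rw [(hφ t).deriv]
    linarith
  have h := hanti (Set.left_mem_Icc.2 zero_le_one) (Set.right_mem_Icc.2 zero_le_one) zero_le_one
  simp only [φ, one_smul, zero_smul, add_zero] at h
  linarith

/-- A gradient step of length `1 / ω` along an inexact gradient `g`. -/
theorem inexact_gradient_step_le {ω : ℝ} (hω : 0 < ω) (hdiff : Differentiable ℝ F)
    (hlip : ∀ x y : E, ‖gradient F x - gradient F y‖ ≤ ω * ‖x - y‖) (x g : E) :
    F (x - (1 / ω) • g) ≤
      F x - 1 / (2 * ω) * ‖gradient F x‖ ^ 2 + 1 / (2 * ω) * ‖gradient F x - g‖ ^ 2 := by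
  have h := le_quadratic_of_lipschitz_gradient hdiff hlip x (-((1 / ω) • g))
  rw [← sub_eq_add_neg, inner_neg_right, real_inner_smul_right, norm_neg, norm_smul,
    Real.norm_of_nonneg (by positivity)] at h
  rw [norm_sub_sq_real]
  refine h.trans_eq ?_
  field_simp
  ring

/-- The Polyak–Łojasiewicz inequality for strongly convex functions. -/
theorem two_mul_gap_le_norm_gradient_sq {μ : ℝ} (hμ : 0 < μ) {x y : E}
    (hconv : F x + ⟪y - x, gradient F x⟫ + μ / 2 * ‖y - x‖ ^ 2 ≤ F y) :
    2 * μ * (F x - F y) ≤ ‖gradient F x‖ ^ 2 := by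
  have hsq := sq_nonneg ‖μ • (y - x) + gradient F x‖
  rw [norm_add_sq_real, real_inner_smul_left, norm_smul, Real.norm_of_nonneg hμ.le] at hsq
  have := mul_le_mul_of_nonneg_left hconv (by positivity : 0 ≤ 2 * μ)
  linarith

end DescentLemma

/-- Deterministic one-round contraction of the optimality gap (core of Theorem 1). -/
theorem stmt_8 (D : ℕ) (F : EuclideanSpace ℝ (Fin D) → ℝ) (ω μ : ℝ)
    (hω : 0 < ω) (hμ : 0 < μ)
    (hdiff : Differentiable ℝ F)
    (hlip : ∀ θ θ' : EuclideanSpace ℝ (Fin D),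
      ‖gradient F θ - gradient F θ'‖ ≤ ω * ‖θ - θ'‖)
    (hconv : ∀ θ θ' : EuclideanSpace ℝ (Fin D),
      F θ' + ⟪θ - θ', gradient F θ'⟫ + μ / 2 * ‖θ - θ'‖ ^ 2 ≤ F θ)
    (θstar : EuclideanSpace ℝ (Fin D)) (hmin : ∀ θ, F θstar ≤ F θ)
    (M : ℕ) (hM : 1 ≤ M) (χ₁ χ₂ : ℝ) (hχ₁ : 0 ≤ χ₁) (hχ₂ : 0 ≤ χ₂)
    (l : ℝ) (hl : l ∈ Set.Ico (0 : ℝ) 1)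
    (hsmall : 4 * χ₂ * (M : ℝ) * l ^ 2 / (1 - l) ^ 2 ≤ 1 / 2)
    (θ ghat : EuclideanSpace ℝ (Fin D)) (Esp Ecom : ℝ)
    (hEcom : 0 ≤ Ecom) (hEsp0 : 0 ≤ Esp)
    (hEsp : Esp ≤ (4 * (M : ℝ) * l ^ 2 / (1 - l) ^ 2) * (χ₁ + χ₂ * ‖gradient F θ‖ ^ 2))
    (herr : ‖gradient F θ - ghat‖ ^ 2 ≤ 2 * (Esp + Ecom)) :
    F (θ - (1 / ω) • ghat) - F θstar ≤
      (1 - μ / ω + 8 * μ * χ₂ * (M : ℝ) * l ^ 2 / (ω * (1 - l) ^ 2)) * (F θ - F θstar)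
        + (1 / ω) * (4 * χ₁ * (M : ℝ) * l ^ 2 / (1 - l) ^ 2 + Ecom) := by
  have hstep := inexact_gradient_step_le hω hdiff hlip θ ghat
  have hPL := two_mul_gap_le_norm_gradient_sq hμ (hconv θstar θ)
  set A : ℝ := 4 * (M : ℝ) * l ^ 2 / (1 - l) ^ 2 with hA
  have hAχ₁ : 4 * χ₁ * (M : ℝ) * l ^ 2 / (1 - l) ^ 2 = A * χ₁ := by rw [hA]; ring
  have hAχ₂ : 4 * χ₂ * (M : ℝ) * l ^ 2 / (1 - l) ^ 2 = A * χ₂ := by rw [hA]; ring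
  have hΨ : 8 * μ * χ₂ * (M : ℝ) * l ^ 2 / (ω * (1 - l) ^ 2) = 2 * μ * (A * χ₂) / ω := by
    rw [hA, mul_comm ω, ← div_div]; ring
  rw [hAχ₂] at hsmall
  rw [hAχ₁, hΨ]
  have hgap := mul_le_mul_of_nonneg_left hPL
    (mul_nonneg (by positivity : 0 ≤ 1 / (2 * ω)) (by linarith : 0 ≤ 1 - 2 * (A * χ₂)))
  have hnoise := mul_le_mul_of_nonneg_left
    (herr.trans (by linarith : _ ≤ 2 * (A * (χ₁ + χ₂ * ‖gradient F θ‖ ^ 2) + Ecom)))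
    (by positivity : 0 ≤ 1 / (2 * ω))
  calc F (θ - (1 / ω) • ghat) - F θstar
      ≤ F θ - F θstar - 1 / (2 * ω) * (1 - 2 * (A * χ₂)) * ‖gradient F θ‖ ^ 2
          + 1 / ω * (A * χ₁ + Ecom) := by
        have : 1 / (2 * ω) * (2 * (A * (χ₁ + χ₂ * ‖gradient F θ‖ ^ 2) + Ecom))
            = 1 / (2 * ω) * (2 * (A * χ₂)) * ‖gradient F θ‖ ^ 2
              + 1 / ω * (A * χ₁ + Ecom) := by
          field_simp
          ring
        linarith
    _ ≤ F θ - F θstar - 1 / (2 * ω) * (1 - 2 * (A * χ₂)) * (2 * μ * (F θ - F θstar))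
          + 1 / ω * (A * χ₁ + Ecom) := by linarith
    _ = _ := by
        field_simp
        ring
end
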